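/- arXiv:2405.04631 — 2 statements merged into one kernel-verified Lean document; each statement's English description precedes it below -/
import Mathlib

section
/- Let F be any field, N ≥ 1 and d ≥ 0. The map φ is an isomorphism of SL_2(F)-representations from Sym^{N−1}E ⊗ ⋀^{N+1}Sym^{d+1}E onto Δ^{(2,1^{N−1})}Sym^d E: that is, φ is injective, its image equals ker μ_N ⊆ ⋀^N Sym^d E ⊗ Sym^d E, and φ(g·x) = g·φ(x) for every g ∈ SL_2(F) and every x in the domain. -/
open MvPolynomial TensorProduct

set_option maxHeartbeats 1000000
set_option synthInstance.maxHeartbeats 400000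

noncomputable section

/-- `Sym' F c` : the `c`-th symmetric power of `E = F²`, realised as the space of
homogeneous polynomials of degree `c` in the two variables `X = X 0`, `Y = X 1`. -/
abbrev Sym' (F : Type*) [Field F] (c : ℕ) : Type _ :=
  ↥(MvPolynomial.homogeneousSubmodule (Fin 2) F c)

variable (F : Type*) [Field F]

/-- The basis monomial `X^(c-i) Y^i` of `Sym' F c`; it is `0` (junk) if `i > c`. -/
def XY (c i : ℕ) : Sym' F c :=
  if h : i ≤ c then
    ⟨(X 0 : MvPolynomial (Fin 2) F) ^ (c - i) * X 1 ^ i, by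
      rw [MvPolynomial.mem_homogeneousSubmodule]
      have := ((isHomogeneous_X_pow (R := F) (0 : Fin 2) (c - i)).mul
        (isHomogeneous_X_pow (R := F) (1 : Fin 2) i))
      rwa [Nat.sub_add_cancel h] at this⟩
  else 0

/-- `F_∧^{(c)}(k) = X^{c-k₁}Y^{k₁} ∧ ⋯ ∧ X^{c-k_r}Y^{k_r}` in `⋀^r (Sym' F c)`. -/
def wedge (c : ℕ) {r : ℕ} (k : Fin r → ℕ) : ⋀[F]^r (Sym' F c) :=
  ⟨ExteriorAlgebra.ιMulti F r fun a => XY F c (k a),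
    ExteriorAlgebra.ιMulti_range F r (Set.mem_range_self _)⟩

/-- `F(i,j) = F_∧^{(d)}(i) ⊗ X^{d-j}Y^j`. -/
def Fp (d : ℕ) {N : ℕ} (i : Fin N → ℕ) (j : ℕ) :
    (⋀[F]^N (Sym' F d)) ⊗[F] (Sym' F d) :=
  wedge F d i ⊗ₜ[F] XY F d j

/-- The multiplication map `μ_N : ⋀^N V ⊗ V → ⋀^{N+1} V` for `V = Sym' F c`. -/
def mu (c N : ℕ) :
    ((⋀[F]^N (Sym' F c)) ⊗[F] (Sym' F c)) →ₗ[F] ⋀[F]^(N + 1) (Sym' F c) :=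
  TensorProduct.lift
    (LinearMap.mk₂ F
      (fun w v => ⟨(w : ExteriorAlgebra F (Sym' F c)) * ExteriorAlgebra.ι F v, by
        have h := Submodule.mul_mem_mul w.2
          (LinearMap.mem_range_self (ExteriorAlgebra.ι F (M := Sym' F c)) v)
        rwa [← pow_succ] at h⟩)
      (fun w w' v => by ext; simp [add_mul])
      (fun a w v => by ext; simp [mul_assoc, Algebra.smul_mul_assoc])
      (fun w v v' => by ext; simp [mul_add])
      (fun a w v => by ext; simp [Algebra.mul_smul_comm]))

/-- The box `B(k) = [k₁,k₂) × ⋯ × [k_N, k_{N+1})` as a finset of multi-indices. -/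
def box {N : ℕ} (k : Fin (N + 1) → ℕ) : Finset (Fin N → ℕ) :=
  Fintype.piFinset fun a : Fin N => Finset.Ico (k a.castSucc) (k a.succ)

/-- `v_{(s,k)} = Σ_{i ∈ B(k)} F(i, s + |k| - N - |i|)`. -/
def vv (d N : ℕ) (s : ℕ) (k : Fin (N + 1) → ℕ) :
    (⋀[F]^N (Sym' F d)) ⊗[F] (Sym' F d) :=
  ∑ i ∈ box k, Fp F d i (s + (∑ a, k a) - N - ∑ a, i a)

/-- A pair `(i, j)` is semistandard (with entries in `{0,…,d}`). -/
def IsSS (d : ℕ) {N : ℕ} (p : (Fin N → ℕ) × ℕ) : Prop :=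
  StrictMono p.1 ∧ (∀ a, p.1 a ≤ d) ∧ p.2 ≤ d ∧
    ∀ a : Fin N, (a : ℕ) = 0 → p.1 a ≤ p.2

/-- The neighbour map `P`. -/
def Pmap {N : ℕ} (p : (Fin N → ℕ) × ℕ) : (Fin N → ℕ) × ℕ :=
  if h : (Finset.univ.filter fun a : Fin N => p.1 a ≤ p.2).Nonempty then
    let α := (Finset.univ.filter fun a : Fin N => p.1 a ≤ p.2).max' h
    (Function.update p.1 α p.2, p.1 α)
  else p

/-- `F_Δ(i,j)`. -/
def FDelta (d : ℕ) {N : ℕ} (p : (Fin N → ℕ) × ℕ) :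
    (⋀[F]^N (Sym' F d)) ⊗[F] (Sym' F d) :=
  if ∃ a, p.1 a = p.2 then Fp F d p.1 p.2
  else Fp F d p.1 p.2 + Fp F d (Pmap p).1 (Pmap p).2

/-- The content multiset of a pair. -/
def ssContent {N : ℕ} (p : (Fin N → ℕ) × ℕ) : Multiset ℕ :=
  p.2 ::ₘ Finset.univ.val.map p.1


/-- The algebra endomorphism of `F[X,Y]` given by the linear substitution
`X_j ↦ Σ_i g_{ij} X_i`, i.e. the action of the matrix `g` on polynomials. -/
def subst (g : Matrix (Fin 2) (Fin 2) F) :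
    MvPolynomial (Fin 2) F →ₐ[F] MvPolynomial (Fin 2) F :=
  aeval fun j => ∑ i, C (g i j) * X i

lemma subst_mem (g : Matrix (Fin 2) (Fin 2) F) (c : ℕ) :
    ∀ p ∈ homogeneousSubmodule (Fin 2) F c,
      subst F g p ∈ homogeneousSubmodule (Fin 2) F c := by
  intro p hp
  rw [mem_homogeneousSubmodule] at hp ⊢
  have h := hp.aeval (fun j => ∑ i, C (g i j) * X i)
    (fun j => IsHomogeneous.sum _ _ _ fun i _ => isHomogeneous_C_mul_X _ _)
  simpa [subst] using h

/-- The action of a `2 × 2` matrix on `Sym^c E`, by linear substitution of the variables. -/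
def rhoSym (g : Matrix (Fin 2) (Fin 2) F) (c : ℕ) : Sym' F c →ₗ[F] Sym' F c :=
  (subst F g).toLinearMap.restrict (subst_mem F g c)

lemma map_mem_exteriorPower {M : Type*} [AddCommGroup M] [Module F M] (f : M →ₗ[F] M) (r : ℕ)
    {x : ExteriorAlgebra F M} (hx : x ∈ ⋀[F]^r M) :
    ExteriorAlgebra.map f x ∈ ⋀[F]^r M := by
  rw [← ExteriorAlgebra.ιMulti_span_fixedDegree] at hx ⊢
  induction hx using Submodule.span_induction with
  | mem y hy =>
      obtain ⟨v, rfl⟩ := hy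
      rw [ExteriorAlgebra.map_apply_ιMulti]
      exact Submodule.subset_span (Set.mem_range_self _)
  | zero => simp
  | add y z _ _ hy hz => rw [map_add]; exact Submodule.add_mem _ hy hz
  | smul a y _ hy => rw [map_smul]; exact Submodule.smul_mem _ a hy

/-- The functorial action of a linear endomorphism of `Sym^c E` on `⋀^r Sym^c E`. -/
def rhoW (c r : ℕ) (f : Sym' F c →ₗ[F] Sym' F c) :
    ↥(⋀[F]^r (Sym' F c)) →ₗ[F] ↥(⋀[F]^r (Sym' F c)) :=
  (ExteriorAlgebra.map f).toLinearMap.restrict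
    (fun _ hx => map_mem_exteriorPower F f r hx)

/-- The domain `Sym^{N-1} E ⊗ ⋀^{N+1} Sym^{d+1} E` of `φ`. -/
abbrev Dom (N d : ℕ) : Type _ := (Sym' F (N - 1)) ⊗[F] ↥(⋀[F]^(N + 1) (Sym' F (d + 1)))

/-- The codomain `⋀^N Sym^d E ⊗ Sym^d E` of `φ`. -/
abbrev Cod (N d : ℕ) : Type _ := ↥(⋀[F]^N (Sym' F d)) ⊗[F] (Sym' F d)

/-- The action of a `2 × 2` matrix on `Sym^{N-1} E ⊗ ⋀^{N+1} Sym^{d+1} E`, by functoriality. -/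
def rhoDom (N d : ℕ) (g : Matrix (Fin 2) (Fin 2) F) : Dom F N d →ₗ[F] Dom F N d :=
  TensorProduct.map (rhoSym F g (N - 1)) (rhoW F (d + 1) (N + 1) (rhoSym F g (d + 1)))

/-- The action of a `2 × 2` matrix on `⋀^N Sym^d E ⊗ Sym^d E`, by functoriality. -/
def rhoCod (N d : ℕ) (g : Matrix (Fin 2) (Fin 2) F) : Cod F N d →ₗ[F] Cod F N d :=
  TensorProduct.map (rhoW F d N (rhoSym F g d)) (rhoSym F g d)


section Helpers

open Matrix

lemma XY_coe {c i : ℕ} (h : i ≤ c) :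
    ((XY F c i : Sym' F c) : MvPolynomial (Fin 2) F) = X 0 ^ (c - i) * X 1 ^ i := by
  simp [XY, h]

/-- exponent -/
def expo (c i : ℕ) : Fin 2 →₀ ℕ := Finsupp.single 0 (c - i) + Finsupp.single 1 i

lemma XY_coe' {c i : ℕ} (h : i ≤ c) :
    ((XY F c i : Sym' F c) : MvPolynomial (Fin 2) F) = monomial (expo c i) 1 := by
  rw [XY_coe F h, X_pow_eq_monomial, X_pow_eq_monomial, monomial_mul, one_mul, expo]

lemma expo_inj {c i j : ℕ} (h : expo c i = expo c j) : i = j := by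
  have := DFunLike.congr_fun h 1
  simpa [expo] using this

lemma XY_li (c : ℕ) : LinearIndependent F (fun i : Fin (c + 1) => XY F c i) := by
  refine LinearIndependent.of_pairwise_dual_eq_zero_one _
    (fun i => (lcoeff F (expo c i)) ∘ₗ (Submodule.subtype _)) ?_ ?_
  · intro i j hij
    simp only [LinearMap.comp_apply, Submodule.subtype_apply, lcoeff_apply]
    rw [XY_coe' F (by omega), coeff_monomial, if_neg]
    intro h
    exact hij (Fin.ext (expo_inj h)).symm
  · intro i
    simp only [LinearMap.comp_apply, Submodule.subtype_apply, lcoeff_apply]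
    rw [XY_coe' F (by omega), coeff_monomial, if_pos rfl]

lemma XY_span (c : ℕ) : ⊤ ≤ Submodule.span F (Set.range (fun i : Fin (c + 1) => XY F c i)) := by
  rintro ⟨p, hp⟩ -
  have : (⟨p, hp⟩ : Sym' F c) = ∑ i : Fin (c + 1), coeff (expo c i) p • XY F c i := by
    apply Subtype.ext
    simp only [Submodule.coe_sum, Submodule.coe_smul]
    ext m
    rw [coeff_sum]
    have hX : ∀ i : Fin (c + 1), coeff m (coeff (expo c i) p •
        ((XY F c i : Sym' F c) : MvPolynomial (Fin 2) F)) =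
        if expo c i = m then coeff m p else 0 := by
      intro i
      rw [coeff_smul, XY_coe' F (by omega), coeff_monomial]
      split_ifs with h
      · simp [h]
      · simp
    simp only [hX]
    by_cases hm : m 0 + m 1 = c
    · have hm1 : expo c (m 1) = m := by
        ext a
        fin_cases a
        · simp [expo]; omega
        · simp [expo]
      rw [Finset.sum_eq_single (⟨m 1, by omega⟩ : Fin (c + 1))]
      · simp [hm1]
      · intro i _ hi
        rw [if_neg]
        intro h
        apply hi
        apply Fin.ext
        apply expo_inj (c := c)
        rw [h, hm1]
      · simp
    · have h0 : coeff m p = 0 := by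
        by_contra h
        rw [mem_homogeneousSubmodule] at hp
        have := hp h
        rw [Finsupp.weight_apply, Finsupp.sum_fintype _ _ (by simp)] at this
        simp [Fin.sum_univ_two] at this
        exact hm this
      simp [h0]
  rw [this]
  exact Submodule.sum_mem _ fun i _ => Submodule.smul_mem _ _ (Submodule.subset_span ⟨i, rfl⟩)

/-- monomial basis -/
def bS (c : ℕ) : Module.Basis (Fin (c + 1)) F (Sym' F c) :=
  Module.Basis.mk (XY_li F c) (XY_span F c)

@[simp] lemma bS_apply (c : ℕ) (i : Fin (c + 1)) : bS F c i = XY F c i := by simp [bS]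

/-- index tuple -/
def kOf {c r : ℕ} (s : Set.powersetCard (Fin (c + 1)) r) : Fin r → ℕ :=
  fun a => (Set.powersetCard.ofFinEmbEquiv.symm s a : Fin (c + 1))

lemma kOf_strictMono {c r : ℕ} (s : Set.powersetCard (Fin (c + 1)) r) : StrictMono (kOf s) := by
  intro a b h
  exact (Set.powersetCard.ofFinEmbEquiv.symm s).strictMono h

lemma kOf_le {c r : ℕ} (s : Set.powersetCard (Fin (c + 1)) r) (a) : kOf s a ≤ c := by
  unfold kOf; omega

lemma kOf_inj {c r : ℕ} {s t : Set.powersetCard (Fin (c + 1)) r} (h : kOf s = kOf t) : s = t := by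
  apply Set.powersetCard.ofFinEmbEquiv.symm.injective
  ext a
  exact congrFun h a

lemma wedge_eq (c : ℕ) {r : ℕ} (k : Fin r → ℕ) :
    wedge F c k = exteriorPower.ιMulti F r (fun a => XY F c (k a)) := rfl

lemma bW_apply (c r : ℕ) (s : Set.powersetCard (Fin (c + 1)) r) :
    (bS F c).exteriorPower r s = wedge F c (kOf s) := by
  rw [exteriorPower.basis_apply, wedge_eq, exteriorPower.ιMulti_family]
  congr 1
  ext a
  simp [kOf]

section D
variable {F}
variable {V S : Type*} [AddCommGroup V] [Module F V] [CommRing S] [Algebra F S]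

/-- determinant alternating map -/
def Dal {r : ℕ} (e : Fin r → V →ₗ[F] S) : V [⋀^Fin r]→ₗ[F] S where
  toMultilinearMap := ((detRowAlternating (R := S) (n := Fin r)).toMultilinearMap.restrictScalars
    F).compLinearMap (fun _ => LinearMap.pi e)
  map_eq_zero_of_eq' := by
    intro v i j hv hij
    exact Matrix.det_zero_of_row_eq hij (by ext a; simp [hv])

lemma Dal_apply {r : ℕ} (e : Fin r → V →ₗ[F] S) (v : Fin r → V) :
    Dal e v = det (of fun b a => e a (v b)) := rfl

/-- induced map on exterior power -/
def DD {r : ℕ} (e : Fin r → V →ₗ[F] S) : ⋀[F]^r V →ₗ[F] S :=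
  exteriorPower.alternatingMapLinearEquiv (Dal e)

lemma DD_ι {r : ℕ} (e : Fin r → V →ₗ[F] S) (v : Fin r → V) :
    DD e (exteriorPower.ιMulti F r v) = det (of fun b a => e a (v b)) := by
  rw [DD, exteriorPower.alternatingMapLinearEquiv_apply_ιMulti, Dal_apply]

lemma DD_alg {r : ℕ} (e : Fin r → V →ₗ[F] S) (G : S →ₐ[F] S) (ω : ⋀[F]^r V) :
    G (DD e ω) = DD (fun a => G.toLinearMap ∘ₗ e a) ω := by
  suffices h : G.toLinearMap ∘ₗ DD e = DD (fun a => G.toLinearMap ∘ₗ e a) from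
    LinearMap.congr_fun h ω
  apply exteriorPower.linearMap_ext
  ext v
  simp only [LinearMap.compAlternatingMap_apply, LinearMap.comp_apply, AlgHom.toLinearMap_apply,
    DD_ι]
  exact AlgHom.map_det G _

lemma DD_perm {r : ℕ} (e : Fin r → V →ₗ[F] S) (σ : Equiv.Perm (Fin r)) (ω : ⋀[F]^r V) :
    DD (fun a => e (σ a)) ω = (Equiv.Perm.sign σ : ℤ) • DD e ω := by
  suffices h : DD (fun a => e (σ a)) = (Equiv.Perm.sign σ : ℤ) • DD e from
    LinearMap.congr_fun h ω
  apply exteriorPower.linearMap_ext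
  ext v
  simp only [LinearMap.compAlternatingMap_apply, LinearMap.smul_apply, DD_ι]
  rw [zsmul_eq_mul]
  exact Matrix.det_permute' σ (of fun b a => e a (v b))

end D

lemma DD_rhoW {S : Type*} [CommRing S] [Algebra F S] {c r : ℕ} (e : Fin r → Sym' F c →ₗ[F] S)
    (f : Sym' F c →ₗ[F] Sym' F c) (ω : ⋀[F]^r (Sym' F c)) :
    DD e (rhoW F c r f ω) = DD (fun a => e a ∘ₗ f) ω := by
  suffices h : DD e ∘ₗ rhoW F c r f = DD (fun a => e a ∘ₗ f) from
    LinearMap.congr_fun h ω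
  apply exteriorPower.linearMap_ext
  ext v
  have : rhoW F c r f (exteriorPower.ιMulti F r v) =
      exteriorPower.ιMulti F r (fun a => f (v a)) := by
    apply Subtype.ext
    exact ExteriorAlgebra.map_apply_ιMulti f v
  simp only [LinearMap.compAlternatingMap_apply, LinearMap.comp_apply, this, DD_ι]

/-- evaluation at the point `a` -/
def ev {A : Type*} (a : A) (c : ℕ) : Sym' F c →ₗ[F] MvPolynomial (A × Fin 2) F :=
  (rename (fun i => (a, i))).toLinearMap ∘ₗ Submodule.subtype _

lemma ev_apply {A : Type*} (a : A) (c : ℕ) (p : Sym' F c) :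
    ev F a c p = rename (fun i => (a, i)) (p : MvPolynomial (Fin 2) F) := rfl

lemma ev_XY {A : Type*} (a : A) {c i : ℕ} (h : i ≤ c) :
    ev F a c (XY F c i) = X (a, 0) ^ (c - i) * X (a, 1) ^ i := by
  rw [ev_apply, XY_coe F h]; simp

/-- domain embedding -/
def PsiDom (N d : ℕ) : Dom F N d →ₗ[F] MvPolynomial (Fin (N + 1) × Fin 2) F :=
  LinearMap.mul' F _ ∘ₗ TensorProduct.map (ev F (Fin.last N) (N - 1))
    (DD (fun a => ev F a (d + 1)))

/-- codomain embedding -/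
def PsiCod (N d : ℕ) : Cod F N d →ₗ[F] MvPolynomial (Fin (N + 1) × Fin 2) F :=
  LinearMap.mul' F _ ∘ₗ TensorProduct.map
    (DD (fun a : Fin N => ev F a.castSucc d)) (ev F (Fin.last N) d)

lemma PsiDom_tmul (N d : ℕ) (p ω) : PsiDom F N d (p ⊗ₜ ω) =
    ev F (Fin.last N) (N - 1) p * DD (fun a => ev F a (d + 1)) ω := by
  simp [PsiDom]

lemma PsiCod_tmul (N d : ℕ) (ω p) : PsiCod F N d (ω ⊗ₜ p) =
    DD (fun a : Fin N => ev F a.castSucc d) ω * ev F (Fin.last N) d p := by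
  simp [PsiCod]

/-- simultaneous substitution -/
def GG {A : Type*} (g : Matrix (Fin 2) (Fin 2) F) :
    MvPolynomial (A × Fin 2) F →ₐ[F] MvPolynomial (A × Fin 2) F :=
  aeval fun q => ∑ i, C (g i q.2) * X (q.1, i)

lemma GG_ev {A : Type*} (g : Matrix (Fin 2) (Fin 2) F) (a : A) (c : ℕ) (p : Sym' F c) :
    GG F g (ev F a c p) = ev F a c (rhoSym F g c p) := by
  simp only [ev_apply, rhoSym]
  have : (GG F g).comp (rename (R := F) (fun i => (a, i))) =
      (rename (fun i => (a, i))).comp (subst F g) := by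
    ext i : 1
    simp [GG, subst]
  exact DFunLike.congr_fun this _

lemma GG_PsiDom (N d : ℕ) (g : Matrix (Fin 2) (Fin 2) F) (x) :
    PsiDom F N d (rhoDom F N d g x) = GG F g (PsiDom F N d x) := by
  induction x using TensorProduct.induction_on with
  | zero => simp
  | add x y hx hy => simp only [map_add, hx, hy]
  | tmul p ω =>
    rw [rhoDom, TensorProduct.map_tmul, PsiDom_tmul, PsiDom_tmul, map_mul, GG_ev, DD_rhoW, DD_alg]
    congr 2
    congr 1
    ext a : 1
    ext p : 1
    exact (GG_ev F g a _ p).symm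

lemma GG_PsiCod (N d : ℕ) (g : Matrix (Fin 2) (Fin 2) F) (x) :
    PsiCod F N d (rhoCod F N d g x) = GG F g (PsiCod F N d x) := by
  induction x using TensorProduct.induction_on with
  | zero => simp
  | add x y hx hy => simp only [map_add, hx, hy]
  | tmul p ω =>
    rw [rhoCod, TensorProduct.map_tmul, PsiCod_tmul, PsiCod_tmul, map_mul, GG_ev, DD_rhoW, DD_alg]
    congr 2
    congr 1
    ext a : 1
    ext p : 1
    exact (GG_ev F g a.castSucc _ p).symm

/-- product of brackets -/
def brk (N : ℕ) : MvPolynomial (Fin (N + 1) × Fin 2) F :=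
  ∏ a : Fin N, (X (a.castSucc, 1) * X (Fin.last N, 0) - X (a.castSucc, 0) * X (Fin.last N, 1))

lemma brk_ne (N : ℕ) : brk F N ≠ 0 := by
  rw [brk, Finset.prod_ne_zero_iff]
  intro a _ h
  have h2 := congrArg (aeval (R := F) (fun q : Fin (N + 1) × Fin 2 =>
    if q = (a.castSucc, 1) ∨ q = (Fin.last N, 0) then (1 : F) else 0)) h
  have hne : a.castSucc ≠ Fin.last N := (Fin.castSucc_lt_last a).ne
  simp [hne, hne.symm] at h2

lemma GG_brk (N : ℕ) (g : Matrix (Fin 2) (Fin 2) F) (hg : g.det = 1) :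
    GG F g (brk F N) = brk F N := by
  simp only [brk, map_prod]
  refine Finset.prod_congr rfl fun a _ => ?_
  simp only [GG, map_sub, map_mul, aeval_X, Fin.sum_univ_two]
  have : (C (g 0 0) * C (g 1 1) - C (g 0 1) * C (g 1 0) :
    MvPolynomial (Fin (N + 1) × Fin 2) F) = 1 := by
    rw [← C_mul, ← C_mul, ← C_sub, ← Matrix.det_fin_two, hg, C_1]
  linear_combination (X (a.castSucc, 1) * X (Fin.last N, 0) -
    X (a.castSucc, 0) * X (Fin.last N, 1)) * this

lemma mu_ι (c N : ℕ) (v : Fin (N + 1) → Sym' F c) :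
    mu F c N (exteriorPower.ιMulti F N (fun a => v a.castSucc) ⊗ₜ v (Fin.last N)) =
      exteriorPower.ιMulti F (N + 1) v := by
  apply Subtype.ext
  simp only [mu, TensorProduct.lift.tmul, LinearMap.mk₂_apply, exteriorPower.ιMulti_apply_coe,
    ExteriorAlgebra.ιMulti_apply]
  rw [List.ofFn_succ', List.concat_eq_append, List.prod_append]
  simp

lemma mu_surj (c N : ℕ) : Function.Surjective (mu F c N) := by
  rw [← LinearMap.range_eq_top, eq_top_iff, ← exteriorPower.ιMulti_span, Submodule.span_le]
  rintro _ ⟨v, rfl⟩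
  exact ⟨_, mu_ι F c N v⟩


section detlemma

variable {S : Type*} [CommRing S] [IsDomain S]

lemma det_id {N D : ℕ} (xs ys : Fin (N + 1) → S) (k : Fin (N + 1) → ℕ) (hk : StrictMono k)
    (hD : ∀ a, k a ≤ D) (hX : xs (Fin.last N) ≠ 0) :
    det (of fun b a : Fin (N + 1) => xs a ^ (D - k b) * ys a ^ (k b)) =
      (-1) ^ N * (xs (Fin.last N) ^ (D - k (Fin.last N)) * ys (Fin.last N) ^ (k 0)) *
      det (of fun b a : Fin N =>
        xs (Fin.last N) ^ (k b.succ - k b.castSucc) *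
          (xs a.castSucc ^ (D - k b.succ) * ys a.castSucc ^ (k b.succ)) -
        ys (Fin.last N) ^ (k b.succ - k b.castSucc) *
          (xs a.castSucc ^ (D - k b.castSucc) * ys a.castSucc ^ (k b.castSucc))) := by
  set U := xs (Fin.last N) with hU
  set W := ys (Fin.last N) with hW
  set m : Fin (N + 1) → Fin (N + 1) → S := fun b a => xs a ^ (D - k b) * ys a ^ (k b) with hm
  have hk0 : ∀ b, k 0 ≤ k b := fun b => hk.monotone (Fin.zero_le b)
  have hks : ∀ b : Fin N, k b.castSucc < k b.succ := fun b => hk b.castSucc_lt_succ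
  let A : Matrix (Fin (N + 1)) (Fin (N + 1)) S := of fun b a => U ^ (k b - k 0) * m b a
  let T : Fin N → Fin (N + 1) → S := fun b a =>
    U ^ (k b.succ - k b.castSucc) * m b.succ a - W ^ (k b.succ - k b.castSucc) * m b.castSucc a
  let B : Matrix (Fin (N + 1)) (Fin (N + 1)) S := of (Fin.cons (m 0)
    (fun b a => U ^ (k b.castSucc - k 0) * T b a))
  have hAB : det A = det B := by
    refine Matrix.det_eq_of_forall_row_eq_smul_add_pred
      (fun b => W ^ (k b.succ - k b.castSucc)) ?_ ?_
    · intro j; simp [A, B]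
    · intro b j
      simp only [A, B, of_apply, Fin.cons_succ, T]
      have : k b.succ - k 0 = (k b.castSucc - k 0) + (k b.succ - k b.castSucc) := by
        have := hk0 b.castSucc; have := hks b; omega
      rw [this, pow_add]
      ring
  have hA : det A = (∏ b, U ^ (k b - k 0)) * det (of m) := by
    rw [← Matrix.det_mul_column]; rfl
  have hB : det B = (-1) ^ N * m 0 (Fin.last N) *
      ((∏ b : Fin N, U ^ (k b.castSucc - k 0)) * det (of fun b a : Fin N => T b a.castSucc)) := by
    rw [← Matrix.det_mul_column, Matrix.det_succ_column B (Fin.last N), Fin.sum_univ_succ]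
    rw [Finset.sum_eq_zero]
    · simp only [B, add_zero, Fin.val_zero, Fin.val_last, zero_add, of_apply, Fin.cons_zero]
      congr 2
      ext b a
      simp [Matrix.submatrix_apply]
    · intro b _
      have : T b (Fin.last N) = 0 := by
        simp only [T, hm, ← hU, ← hW]
        have h1 := hks b
        have h2 := hD b.succ
        have e1 : D - k b.castSucc = (k b.succ - k b.castSucc) + (D - k b.succ) := by omega
        have e2 : k b.succ = (k b.succ - k b.castSucc) + k b.castSucc := by omega
        rw [e1, pow_add]
        nth_rw 3 [e2]
        rw [pow_add]
        ring
      simp [B, this]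
  have hprod : (∏ b : Fin (N + 1), U ^ (k b - k 0)) =
      (∏ b : Fin N, U ^ (k b.castSucc - k 0)) * U ^ (k (Fin.last N) - k 0) :=
    Fin.prod_univ_castSucc _
  have hne : (∏ b : Fin (N + 1), U ^ (k b - k 0)) ≠ 0 :=
    Finset.prod_ne_zero_iff.mpr fun b _ => pow_ne_zero _ hX
  apply mul_left_cancel₀ hne
  change _ * det (of m) = _ * (_ * det (of fun b a : Fin N => T b a.castSucc))
  rw [← hA, hAB, hB, hprod]
  have e3 : m 0 (Fin.last N) =
      U ^ (k (Fin.last N) - k 0) * (U ^ (D - k (Fin.last N)) * W ^ (k 0)) := by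
    simp only [hm, ← hU, ← hW]
    rw [← mul_assoc, ← pow_add]
    congr 2
    have := hk0 (Fin.last N); have := hD (Fin.last N); omega
  rw [e3]
  ring

/-- telescoping -/
lemma tele (x y U W : S) {d p q : ℕ} (hpq : p ≤ q) (hq : q ≤ d + 1) :
    (y * U - x * W) * ∑ i ∈ Finset.Ico p q, (U ^ (i - p) * W ^ (q - 1 - i)) * (x ^ (d - i) * y ^ i) =
      U ^ (q - p) * (x ^ (d + 1 - q) * y ^ q) - W ^ (q - p) * (x ^ (d + 1 - p) * y ^ p) := by
  have h : ∀ i ∈ Finset.Ico p q, (y * U - x * W) *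
      ((U ^ (i - p) * W ^ (q - 1 - i)) * (x ^ (d - i) * y ^ i)) =
      (fun i => U ^ (i - p) * W ^ (q - i) * (x ^ (d + 1 - i) * y ^ i)) (i + 1) -
      (fun i => U ^ (i - p) * W ^ (q - i) * (x ^ (d + 1 - i) * y ^ i)) i := by
    intro i hi
    rw [Finset.mem_Ico] at hi
    have e1 : i + 1 - p = (i - p) + 1 := by omega
    have e2 : q - i = (q - 1 - i) + 1 := by omega
    have e3 : d + 1 - i = (d - i) + 1 := by omega
    have e4 : q - (i + 1) = q - 1 - i := by omega
    have e5 : d + 1 - (i + 1) = d - i := by omega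
    simp only [e1, e2, e3, e4, e5]
    ring
  rw [Finset.mul_sum, Finset.sum_congr rfl h,
    Finset.sum_Ico_sub (fun i => U ^ (i - p) * W ^ (q - i) * (x ^ (d + 1 - i) * y ^ i)) hpq]
  simp

end detlemma

lemma box_mem {N : ℕ} {k : Fin (N + 1) → ℕ} {i : Fin N → ℕ} :
    i ∈ box k ↔ ∀ a : Fin N, k a.castSucc ≤ i a ∧ i a < k a.succ := by
  simp [box]

lemma j_eq {N : ℕ} {k : Fin (N + 1) → ℕ} {i : Fin N → ℕ} (hi : i ∈ box k) (s : ℕ) :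
    s + (∑ a, k a) - N - ∑ a, i a = s + k 0 + ∑ b : Fin N, (k b.succ - 1 - i b) := by
  rw [box_mem] at hi
  have h : ∑ b : Fin N, k b.succ = (∑ b : Fin N, (k b.succ - 1 - i b)) + N + ∑ b, i b := by
    have h : ∑ b : Fin N, k b.succ = ∑ b : Fin N, ((k b.succ - 1 - i b) + 1 + i b) := by
      refine Finset.sum_congr rfl fun b _ => ?_
      have := hi b; omega
    rw [h, Finset.sum_add_distrib, Finset.sum_add_distrib]
    simp
  rw [Fin.sum_univ_succ, h]
  omega

lemma j_eq2 {N : ℕ} {k : Fin (N + 1) → ℕ} {i : Fin N → ℕ} (hi : i ∈ box k) :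
    k 0 + ∑ b : Fin N, (k b.succ - 1 - i b) + ∑ b : Fin N, (i b - k b.castSucc) + N
      = k (Fin.last N) := by
  rw [box_mem] at hi
  have h : ∑ b : Fin N, k b.succ = (∑ b : Fin N, (k b.succ - 1 - i b)) +
      ∑ b : Fin N, (i b - k b.castSucc) + N + ∑ b : Fin N, k b.castSucc := by
    have h : ∑ b : Fin N, k b.succ = ∑ b : Fin N, ((k b.succ - 1 - i b) +
        (i b - k b.castSucc) + 1 + k b.castSucc) := by
      refine Finset.sum_congr rfl fun b _ => ?_
      have := hi b; omega
    rw [h, Finset.sum_add_distrib, Finset.sum_add_distrib, Finset.sum_add_distrib]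
    simp
  have h2 := Fin.sum_univ_succ k
  have h3 := Fin.sum_univ_castSucc k
  omega

/-- The key identity. -/
lemma key (N d s : ℕ) (hs : s < N) (k : Fin (N + 1) → ℕ) (hk : StrictMono k)
    (hD : ∀ a, k a ≤ d + 1) :
    PsiDom F N d (XY F (N - 1) s ⊗ₜ wedge F (d + 1) k) =
      (-1) ^ N * brk F N * PsiCod F N d (vv F d N s k) := by
  set U : MvPolynomial (Fin (N + 1) × Fin 2) F := X (Fin.last N, 0) with hU
  set W : MvPolynomial (Fin (N + 1) × Fin 2) F := X (Fin.last N, 1) with hW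
  let h : Fin N → ℕ → Fin N → MvPolynomial (Fin (N + 1) × Fin 2) F := fun b i a =>
    (U ^ (i - k b.castSucc) * W ^ (k b.succ - 1 - i)) *
      (X (a.castSucc, 0) ^ (d - i) * X (a.castSucc, 1) ^ i)
  have hcod : PsiCod F N d (vv F d N s k) =
      (U ^ (N - 1 - s) * W ^ s) * (U ^ (d + 1 - k (Fin.last N)) * W ^ (k 0)) *
      det (of fun b a : Fin N => ∑ i ∈ Finset.Ico (k b.castSucc) (k b.succ), h b i a) := by
    have hdet : det (of fun b a : Fin N => ∑ i ∈ Finset.Ico (k b.castSucc) (k b.succ), h b i a) =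
        ∑ i ∈ box k, det (of fun b a : Fin N => h b (i b) a) := by
      have := (detRowAlternating (R := MvPolynomial (Fin (N + 1) × Fin 2) F)
        (n := Fin N)).toMultilinearMap.map_sum_finset h
        (fun b => Finset.Ico (k b.castSucc) (k b.succ))
      rw [box]
      refine Eq.trans ?_ this
      congr 1
      ext b a
      simp [Finset.sum_apply]
    rw [hdet, vv, map_sum, Finset.mul_sum]
    refine Finset.sum_congr rfl fun i hi => ?_
    have hi' := box_mem.mp hi
    have hL := j_eq2 hi
    have hle := hD (Fin.last N)
    rw [Fp, PsiCod_tmul, wedge_eq, DD_ι, j_eq hi, ev_XY F _ (by omega)]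
    simp only [h]
    have hc : det (of fun b a : Fin N => (U ^ (i b - k b.castSucc) * W ^ (k b.succ - 1 - i b)) *
      (X (a.castSucc, 0) ^ (d - i b) * X (a.castSucc, 1) ^ (i b))) =
      (∏ b, (U ^ (i b - k b.castSucc) * W ^ (k b.succ - 1 - i b))) *
      det (of fun b a : Fin N => ((X (a.castSucc, 0) ^ (d - i b) * X (a.castSucc, 1) ^ (i b)) :
        MvPolynomial (Fin (N + 1) × Fin 2) F)) := by
      rw [← Matrix.det_mul_column]; rfl
    rw [hc, Finset.prod_mul_distrib, Finset.prod_pow_eq_pow_sum, Finset.prod_pow_eq_pow_sum]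
    have hm : (of fun b a : Fin N => ev F a.castSucc d (XY F d (i b))) =
        (of fun b a : Fin N => ((X (a.castSucc, 0) ^ (d - i b) * X (a.castSucc, 1) ^ (i b)) :
        MvPolynomial (Fin (N + 1) × Fin 2) F)) := by
      ext b a : 2
      have := hi' b
      have := hD b.succ
      simp only [of_apply]
      rw [ev_XY F _ (by omega)]
    rw [hm]
    have e : d - (s + k 0 + ∑ b : Fin N, (k b.succ - 1 - i b)) =
      (N - 1 - s) + (d + 1 - k (Fin.last N)) + ∑ b : Fin N, (i b - k b.castSucc) := by omega
    rw [e]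
    simp only [pow_add]
    ring
  rw [hcod, PsiDom_tmul, wedge_eq, DD_ι, ev_XY F _ (by omega)]
  have hm : (of fun b a : Fin (N + 1) => ev F a (d + 1) (XY F (d + 1) (k b))) =
      (of fun b a : Fin (N + 1) => ((X (a, 0) ^ (d + 1 - k b) * X (a, 1) ^ (k b)) :
      MvPolynomial (Fin (N + 1) × Fin 2) F)) := by
    ext b a : 2
    simp only [of_apply]
    rw [ev_XY F _ (hD b)]
  rw [hm, det_id (fun a => X (a, 0)) (fun a => X (a, 1)) k hk hD (X_ne_zero _)]
  have hm2 : det (of fun b a : Fin N =>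
        U ^ (k b.succ - k b.castSucc) *
          (X (a.castSucc, 0) ^ (d + 1 - k b.succ) * X (a.castSucc, 1) ^ (k b.succ)) -
        W ^ (k b.succ - k b.castSucc) *
          (X (a.castSucc, 0) ^ (d + 1 - k b.castSucc) * X (a.castSucc, 1) ^ (k b.castSucc))) =
      brk F N * det (of fun b a : Fin N => ∑ i ∈ Finset.Ico (k b.castSucc) (k b.succ), h b i a) := by
    rw [brk, ← Matrix.det_mul_row]
    congr 1
    ext b a : 2
    simp only [of_apply, h]
    rw [← hU, ← hW, tele _ _ _ _ (hk b.castSucc_lt_succ).le (hD _)]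
  rw [hm2]
  ring

lemma mu_Fp (d N : ℕ) (i : Fin N → ℕ) (j : ℕ) :
    mu F d N (Fp F d i j) = wedge F d (Fin.snoc i j : Fin (N + 1) → ℕ) := by
  rw [wedge_eq, ← mu_ι, Fp, wedge_eq]
  simp

lemma exists_cell {N : ℕ} (k : Fin (N + 1) → ℕ) (j : ℕ) (h0 : k 0 ≤ j) (h1 : j < k (Fin.last N)) :
    ∃ a : Fin N, k a.castSucc ≤ j ∧ j < k a.succ := by
  by_contra! h
  have : ∀ a : Fin (N + 1), k a ≤ j := by
    intro a
    induction a using Fin.induction with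
    | zero => exact h0
    | succ a ih => exact h a ih
  exact absurd (this (Fin.last N)) (by omega)

lemma cell_unique {N : ℕ} {k : Fin (N + 1) → ℕ} (hk : StrictMono k) {j : ℕ} {a a' : Fin N}
    (h : k a.castSucc ≤ j ∧ j < k a.succ) (h' : k a'.castSucc ≤ j ∧ j < k a'.succ) : a = a' := by
  have h1 : a.castSucc < a'.succ := hk.lt_iff_lt.mp (by omega)
  have h2 : a'.castSucc < a.succ := hk.lt_iff_lt.mp (by omega)
  simp only [Fin.lt_def, Fin.val_castSucc, Fin.val_succ] at h1 h2
  apply Fin.ext; omega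

lemma mu_vv (N d s : ℕ) (hs : s < N) (k : Fin (N + 1) → ℕ) (hk : StrictMono k) :
    mu F d N (vv F d N s k) = 0 := by
  have : Nonempty (Fin N) := ⟨⟨s, hs⟩⟩
  have hex := exists_cell k
  choose! af haf using hex
  let J : (Fin N → ℕ) → ℕ := fun i => s + (∑ a, k a) - N - ∑ a, i a
  have hJ : ∀ i ∈ box k, k 0 ≤ J i ∧ J i < k (Fin.last N) := by
    intro i hi
    simp only [J]
    rw [j_eq hi]
    have := j_eq2 hi
    omega
  have hA : ∀ i ∈ box k, k (af (J i)).castSucc ≤ J i ∧ J i < k (af (J i)).succ := fun i hi =>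
    haf _ (hJ i hi).1 (hJ i hi).2
  let g : (Fin N → ℕ) → (Fin N → ℕ) := fun i => Function.update i (af (J i)) (J i)
  have hg : ∀ i ∈ box k, g i ∈ box k := by
    intro i hi
    rw [box_mem]
    intro a
    simp only [g]
    by_cases h : a = af (J i)
    · subst h
      simpa using hA i hi
    · rw [Function.update_of_ne h]
      exact box_mem.mp hi a
  have hJg : ∀ i ∈ box k, J (g i) = i (af (J i)) := by
    intro i hi
    have h1 : ∑ a, g i a + i (af (J i)) = ∑ a, i a + J i := by
      simp only [g]
      rw [Finset.sum_update_of_mem (Finset.mem_univ _),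
        ← Finset.sum_sdiff (Finset.subset_univ {af (J i)}) (f := i), Finset.sum_singleton]
      ring
    have h2 := j_eq hi s
    have h3 := j_eq2 hi
    have h4 : J i = s + (∑ a, k a) - N - ∑ a, i a := rfl
    have h5 : J (g i) = s + (∑ a, k a) - N - ∑ a, g i a := rfl
    have h6 : N + ∑ a, i a ≤ ∑ a, k a := by
      rw [Fin.sum_univ_succ]
      have : N + ∑ a, i a ≤ ∑ a : Fin N, k a.succ := by
        have h : ∑ a : Fin N, (1 + i a) ≤ ∑ a : Fin N, k a.succ := by
          refine Finset.sum_le_sum fun a _ => ?_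
          have := box_mem.mp hi a
          omega
        rw [Finset.sum_add_distrib] at h
        simpa using h
      omega
    omega
  have hag : ∀ i ∈ box k, af (J (g i)) = af (J i) := by
    intro i hi
    have h1 := hA _ (hg i hi)
    rw [hJg i hi] at h1 ⊢
    exact cell_unique hk h1 (box_mem.mp hi _)
  rw [vv, map_sum]
  simp only [mu_Fp]
  refine Finset.sum_involution (fun i _ => g i) ?_ ?_ (fun i hi => hg i hi) ?_
  · intro i hi
    change wedge F d (Fin.snoc i (J i) : Fin (N + 1) → ℕ) +
      wedge F d (Fin.snoc (g i) (J (g i)) : Fin (N + 1) → ℕ) = 0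
    have hne : (af (J i)).castSucc ≠ Fin.last N := (Fin.castSucc_lt_last _).ne
    have hsw : (Fin.snoc (g i) (J (g i)) : Fin (N + 1) → ℕ) =
        (Fin.snoc i (J i) : Fin (N + 1) → ℕ) ∘ Equiv.swap (af (J i)).castSucc (Fin.last N) := by
      funext a
      rw [hJg i hi, Function.comp_apply]
      induction a using Fin.lastCases with
      | last => simp
      | cast a =>
        by_cases h : a = af (J i)
        · rw [h]; simp [g]
        · rw [Equiv.swap_apply_of_ne_of_ne (by simpa using h) (Fin.castSucc_lt_last _).ne]
          simp [g, h]
    rw [hsw, wedge_eq, wedge_eq]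
    have := (exteriorPower.ιMulti F (N + 1)).map_swap
      (fun a => XY F d ((Fin.snoc i (J i) : Fin (N + 1) → ℕ) a)) hne
    rw [show (fun a => XY F d (((Fin.snoc i (J i) : Fin (N + 1) → ℕ) ∘
      Equiv.swap (af (J i)).castSucc (Fin.last N)) a)) =
      (fun a => XY F d ((Fin.snoc i (J i) : Fin (N + 1) → ℕ) a)) ∘
      Equiv.swap (af (J i)).castSucc (Fin.last N) from rfl, this, add_neg_cancel]
  · intro i hi hne heq
    apply hne
    change wedge F d (Fin.snoc i (J i) : Fin (N + 1) → ℕ) = 0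
    have h1 : i (af (J i)) = J i := by
      have h2 := congrFun heq (af (J i))
      simp only [g, Function.update_self] at h2
      exact h2.symm
    rw [wedge_eq]
    refine (exteriorPower.ιMulti F (N + 1)).map_eq_zero_of_eq _ (i := (af (J i)).castSucc)
      (j := Fin.last N) ?_ (Fin.castSucc_lt_last _).ne
    simp [h1]
  · intro i hi
    have h1 := hag i hi
    have h2 := hJg i hi
    change Function.update (g i) (af (J (g i))) (J (g i)) = i
    rw [h1, h2]
    simp [g]


lemma perm_eq {r : ℕ} {k l : Fin r → ℕ} (hk : StrictMono k) (hl : StrictMono l)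
    (σ : Equiv.Perm (Fin r)) (h : l ∘ σ = k) : l = k ∧ σ = 1 := by
  have h1 : l = k := by
    apply (StrictMono.range_inj hl hk).mp
    rw [← h, Function.Surjective.range_comp σ.surjective]
  refine ⟨h1, ?_⟩
  ext a : 1
  apply hl.injective
  have := congrFun h a
  rw [← h1] at this
  simpa using this

/-- exponent vector -/
def EE {A : Type*} [Finite A] (c : ℕ) (q : A → ℕ) : A × Fin 2 →₀ ℕ :=
  Finsupp.equivFunOnFinite.symm (fun p => if p.2 = 0 then c - q p.1 else q p.1)

lemma EE_inj {A : Type*} [Finite A] {c : ℕ} {q q' : A → ℕ} (h : EE c q = EE c q') : q = q' := by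
  funext a
  have := DFunLike.congr_fun h (a, 1)
  simpa [EE] using this

lemma EE_mon {A : Type*} [Fintype A] (c : ℕ) (q : A → ℕ) :
    (∏ a, (X (a, 0) ^ (c - q a) * X (a, 1) ^ (q a)) : MvPolynomial (A × Fin 2) F) =
      monomial (EE c q) 1 := by
  rw [monomial_eq, Finsupp.prod_fintype _ _ (by simp), Fintype.prod_prod_type]
  simp [Fin.prod_univ_two, EE]

lemma coeff_Cod (N d : ℕ) (k l : Fin N → ℕ) (hk : StrictMono k) (hl : StrictMono l)
    (hld : ∀ a, l a ≤ d) (j j' : ℕ) (hj : j ≤ d) :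
    coeff (EE d (Fin.snoc k j' : Fin (N + 1) → ℕ))
      (PsiCod F N d (wedge F d l ⊗ₜ XY F d j)) = if l = k ∧ j = j' then 1 else 0 := by
  have h : PsiCod F N d (wedge F d l ⊗ₜ XY F d j) =
      ∑ σ : Equiv.Perm (Fin N), (Equiv.Perm.sign σ) •
        monomial (EE d (Fin.snoc (l ∘ σ) j : Fin (N + 1) → ℕ)) (1 : F) := by
    rw [PsiCod_tmul, wedge_eq, DD_ι, det_apply, Finset.sum_mul]
    refine Finset.sum_congr rfl fun σ _ => ?_
    rw [← EE_mon, Fin.prod_univ_castSucc, smul_mul_assoc]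
    congr 2
    · refine Finset.prod_congr rfl fun a _ => ?_
      simp only [of_apply]
      rw [ev_XY F _ (hld _)]
      simp
    · rw [ev_XY F _ hj]; simp
  rw [h, coeff_sum]
  have h2 : ∀ σ : Equiv.Perm (Fin N), coeff (EE d (Fin.snoc k j' : Fin (N + 1) → ℕ))
      ((Equiv.Perm.sign σ) • monomial (EE d (Fin.snoc (l ∘ σ) j : Fin (N + 1) → ℕ)) (1 : F)) =
      if σ = 1 then (if l = k ∧ j = j' then 1 else 0) else 0 := by
    intro σ
    rw [Units.smul_def, coeff_smul, coeff_monomial]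
    split_ifs with h1 h2 h3 h4 h5
    · simp [h2]
    · have := Fin.snoc_injective2 (EE_inj h1)
      exact absurd ⟨(perm_eq hk hl σ this.1).1, this.2⟩ h3
    · have := Fin.snoc_injective2 (EE_inj h1)
      exact absurd (perm_eq hk hl σ this.1).2 h2
    · exfalso
      apply h1
      rw [h4, h5.1, h5.2]
      rfl
    · simp
    · simp
  simp only [h2]
  simp

lemma PsiCod_inj (N d : ℕ) : Function.Injective (PsiCod F N d) := by
  let B := ((bS F d).exteriorPower N).tensorProduct (bS F d)
  rw [injective_iff_map_eq_zero]
  intro x hx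
  apply B.repr.injective
  rw [map_zero]
  ext t
  have h : (lcoeff F (EE d (Fin.snoc (kOf t.1) (t.2 : ℕ) : Fin (N + 1) → ℕ))) ∘ₗ PsiCod F N d =
      B.coord t := by
    apply B.ext
    intro u
    rw [Module.Basis.coord_apply, Module.Basis.repr_self, LinearMap.comp_apply, lcoeff_apply,
      Module.Basis.tensorProduct_apply, bW_apply, bS_apply,
      coeff_Cod F N d _ _ (kOf_strictMono _) (kOf_strictMono _) (kOf_le _) _ _ (by omega),
      Finsupp.single_apply]
    congr 1
    rw [eq_iff_iff]
    constructor
    · rintro ⟨h1, h2⟩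
      exact Prod.ext (kOf_inj h1) (Fin.ext h2)
    · rintro rfl
      exact ⟨rfl, rfl⟩
  have := LinearMap.congr_fun h x
  rw [LinearMap.comp_apply, hx, map_zero] at this
  exact this.symm

lemma coeff_DD (r c : ℕ) (k l : Fin r → ℕ) (hk : StrictMono k) (hl : StrictMono l)
    (hld : ∀ a, l a ≤ c) :
    coeff (EE c k) (DD (fun a : Fin r => ev F a c) (wedge F c l)) = if l = k then 1 else 0 := by
  have h : DD (fun a : Fin r => ev F a c) (wedge F c l) =
      ∑ σ : Equiv.Perm (Fin r), (Equiv.Perm.sign σ) • monomial (EE c (l ∘ σ)) (1 : F) := by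
    rw [wedge_eq, DD_ι, det_apply]
    refine Finset.sum_congr rfl fun σ _ => ?_
    rw [← EE_mon]
    congr 1
    refine Finset.prod_congr rfl fun a _ => ?_
    simp only [of_apply]
    rw [ev_XY F _ (hld _)]
    simp
  rw [h, coeff_sum]
  have h2 : ∀ σ : Equiv.Perm (Fin r), coeff (EE c k)
      ((Equiv.Perm.sign σ) • monomial (EE c (l ∘ σ)) (1 : F)) =
      if σ = 1 then (if l = k then 1 else 0) else 0 := by
    intro σ
    rw [Units.smul_def, coeff_smul, coeff_monomial]
    split_ifs with h1 h2 h3 h4 h5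
    · simp [h2]
    · exact absurd (perm_eq hk hl σ (EE_inj h1)).1 h3
    · exact absurd (perm_eq hk hl σ (EE_inj h1)).2 h2
    · exfalso
      apply h1
      rw [h4, h5]
      rfl
    · simp
    · simp
  simp only [h2]
  simp

lemma DD_inj (r c : ℕ) : Function.Injective (DD (fun a : Fin r => ev F a c)) := by
  let B := (bS F c).exteriorPower r
  rw [injective_iff_map_eq_zero]
  intro x hx
  apply B.repr.injective
  rw [map_zero]
  ext t
  have h : (lcoeff F (EE c (kOf t))) ∘ₗ DD (fun a : Fin r => ev F a c) = B.coord t := by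
    apply B.ext
    intro u
    rw [Module.Basis.coord_apply, Module.Basis.repr_self, LinearMap.comp_apply, lcoeff_apply,
      bW_apply, coeff_DD F r c _ _ (kOf_strictMono _) (kOf_strictMono _) (kOf_le _),
      Finsupp.single_apply]
    congr 1
    rw [eq_iff_iff]
    exact ⟨kOf_inj, fun h => h ▸ rfl⟩
  have := LinearMap.congr_fun h x
  rw [LinearMap.comp_apply, hx, map_zero] at this
  exact this.symm

lemma PsiDom_inj (n d : ℕ) : Function.Injective (PsiDom F (n + 1) d) := by
  rw [injective_iff_map_eq_zero]
  intro x hx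
  obtain ⟨c, rfl⟩ := TensorProduct.eq_repr_basis_left (bS F n) x
  set δ : Fin (n + 1) → MvPolynomial (Fin (n + 1 + 1) × Fin 2) F :=
    fun i => DD (fun a : Fin (n + 1 + 1) => ev F a (d + 1)) (c i) with hδ
  rw [Finsupp.sum_fintype _ _ (by simp), map_sum] at hx
  have hx1 : ∑ i : Fin (n + 1), ev F (Fin.last (n + 1)) n (XY F n i) * δ i = 0 := by
    rw [← hx]
    refine Finset.sum_congr rfl fun i _ => ?_
    rw [bS_apply]
    exact (PsiDom_tmul F (n + 1) d _ _).symm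
  have hx2 : ∀ b : Fin (n + 1 + 1), ∑ i : Fin (n + 1), ev F b n (XY F n i) * δ i = 0 := by
    intro b
    let σ : Equiv.Perm (Fin (n + 1 + 1)) := Equiv.swap b (Fin.last (n + 1))
    let G : MvPolynomial (Fin (n + 1 + 1) × Fin 2) F →ₐ[F]
      MvPolynomial (Fin (n + 1 + 1) × Fin 2) F := rename (Prod.map σ id)
    have hG : ∀ a m (p : Sym' F m), G (ev F a m p) = ev F (σ a) m p := by
      intro a m p
      simp only [G, ev_apply, rename_rename]
      rfl
    have hGδ : ∀ i, G (δ i) = (Equiv.Perm.sign σ : ℤ) • δ i := by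
      intro i
      simp only [hδ]
      rw [DD_alg, ← DD_perm (fun a : Fin (n + 1 + 1) => ev F a (d + 1)) σ]
      congr 1
      congr 1
      funext a
      ext p : 1
      exact hG a _ p
    have h := congrArg G hx1
    rw [map_sum, map_zero] at h
    simp only [map_mul, hG, hGδ, mul_smul_comm] at h
    rw [← Finset.smul_sum] at h
    have hb : σ (Fin.last (n + 1)) = b := by simp [σ]
    rw [hb] at h
    rcases Int.units_eq_one_or (Equiv.Perm.sign σ) with hs | hs
    · simpa [hs] using h
    · simpa [hs] using h
  have hδ0 : δ = 0 := by
    refine Matrix.eq_zero_of_mulVec_eq_zero (M := projVandermonde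
      (fun a : Fin (n + 1) => (X (a.castSucc, 1) : MvPolynomial (Fin (n + 1 + 1) × Fin 2) F))
      (fun a => X (a.castSucc, 0))) ?_ ?_
    · rw [det_projVandermonde]
      refine Finset.prod_ne_zero_iff.mpr fun a _ => Finset.prod_ne_zero_iff.mpr fun b hb h => ?_
      have hab : a < b := Finset.mem_Ioi.mp hb
      have h2 := congrArg (aeval (R := F) (fun q : Fin (n + 1 + 1) × Fin 2 =>
        if q = (b.castSucc, 1) ∨ q = (a.castSucc, 0) then (1 : F) else 0)) h
      simp [hab.ne, hab.ne'] at h2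
    · funext a
      rw [Matrix.mulVec, dotProduct, Pi.zero_apply, ← hx2 a.castSucc]
      refine Finset.sum_congr rfl fun i _ => ?_
      rw [projVandermonde_apply, ev_XY F _ (by omega), Fin.val_rev,
        show n + 1 - (i.1 + 1) = n - i.1 by omega]
      ring
  have hc : c = 0 := by
    ext1 i
    apply DD_inj F (n + 1 + 1) (d + 1)
    rw [Finsupp.zero_apply, map_zero]
    exact congrFun hδ0 i
  rw [hc, Finsupp.sum_zero_index]

instance symFinite (c : ℕ) : Module.Finite F (Sym' F c) := Module.Finite.of_basis (bS F c)

lemma finrank_sym (c : ℕ) : Module.finrank F (Sym' F c) = c + 1 := by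
  rw [Module.finrank_eq_card_basis (bS F c), Fintype.card_fin]

lemma numeric (N d : ℕ) : N * (d + 2).choose (N + 1) + (d + 1).choose (N + 1) =
    (d + 1).choose N * (d + 1) := by
  have h1 : (d + 2).choose (N + 1) = (d + 1).choose N + (d + 1).choose (N + 1) :=
    Nat.choose_succ_succ _ _
  have h2 := Nat.choose_succ_right_eq (d + 1) N
  rw [h1]
  by_cases h : N ≤ d + 1
  · obtain ⟨m, hm⟩ := Nat.exists_eq_add_of_le h
    rw [hm] at h2 ⊢
    rw [Nat.add_sub_cancel_left] at h2
    linarith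
  · rw [Nat.choose_eq_zero_of_lt (by omega : d + 1 < N),
      Nat.choose_eq_zero_of_lt (by omega : d + 1 < N + 1)]
    simp

lemma dom_ext {T : Type*} [AddCommGroup T] [Module F T] (N d : ℕ) (hN : 0 < N)
    (f g : Dom F N d →ₗ[F] T)
    (h : ∀ s < N, ∀ k : Fin (N + 1) → ℕ, StrictMono k → (∀ a, k a ≤ d + 1) →
      f (XY F (N - 1) s ⊗ₜ[F] wedge F (d + 1) k) = g (XY F (N - 1) s ⊗ₜ[F] wedge F (d + 1) k)) :
    f = g := by
  apply ((bS F (N - 1)).tensorProduct ((bS F (d + 1)).exteriorPower (N + 1))).ext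
  intro u
  rw [Module.Basis.tensorProduct_apply, bW_apply, bS_apply]
  exact h _ (by omega) _ (kOf_strictMono _) (kOf_le _)

lemma abstract_range {V W U : Type*} [AddCommMonoid V] [Module F V] [AddCommMonoid W] [Module F W]
    [AddCommMonoid U] [Module F U] [hfV : Module.Finite F V] [hfW : Module.Finite F W]
    (f : V →ₗ[F] W) (m : W →ₗ[F] U)
    (hf : Function.Injective f) (hm : Function.Surjective m)
    (hle : LinearMap.range f ≤ LinearMap.ker m)
    (hd : Module.finrank F V + Module.finrank F U = Module.finrank F W) :
    LinearMap.range f = LinearMap.ker m := by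
  letI : AddCommGroup V := Module.addCommMonoidToAddCommGroup F
  letI : AddCommGroup W := Module.addCommMonoidToAddCommGroup F
  letI : AddCommGroup U := Module.addCommMonoidToAddCommGroup F
  apply Submodule.eq_of_le_of_finrank_eq hle
  have h1 := LinearMap.finrank_range_of_inj hf
  have h2 := m.finrank_range_add_finrank_ker
  rw [LinearMap.range_eq_top.mpr hm, finrank_top] at h2
  omega

end Helpers

/-- Theorem 1.1 of the paper. For any field `F`, the map `φ`, defined on the
canonical basis by `φ(X^{N-1-s}Y^s ⊗ F_∧^{(d+1)}(k)) = Σ_{i ∈ B(k)} F(i, s+|k|-N-|i|)`, is an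
isomorphism of `SL₂(F)`-representations
`Sym^{N-1} E ⊗ ⋀^{N+1} Sym^{d+1} E ≅ Δ^{(2,1^{N-1})} Sym^d E`: it is injective, its range is
`Δ^{(2,1^{N-1})} Sym^d E = ker μ_N`, and it commutes with the action of every `g ∈ SL₂(F)`. -/
theorem statement0 (F : Type*) [Field F] (N d : ℕ) (hN : 0 < N)
    (φ : Dom F N d →ₗ[F] Cod F N d)
    (hφ : ∀ s < N, ∀ k : Fin (N + 1) → ℕ, StrictMono k → (∀ a, k a ≤ d + 1) →
      φ (XY F (N - 1) s ⊗ₜ[F] wedge F (d + 1) k) = vv F d N s k) :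
    Function.Injective φ ∧
    LinearMap.range φ = LinearMap.ker (mu F d N) ∧
    ∀ g : Matrix.SpecialLinearGroup (Fin 2) F, ∀ x : Dom F N d,
      φ (rhoDom F N d (g : Matrix (Fin 2) (Fin 2) F) x)
        = rhoCod F N d (g : Matrix (Fin 2) (Fin 2) F) (φ x) := by
  have hkey : ∀ x, PsiDom F N d x = (-1) ^ N * brk F N * PsiCod F N d (φ x) := by
    intro x
    have h : PsiDom F N d =
        LinearMap.mulLeft F ((-1) ^ N * brk F N) ∘ₗ PsiCod F N d ∘ₗ φ := by
      apply dom_ext F N d hN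
      intro s hs k hk hD
      simp only [LinearMap.comp_apply, LinearMap.mulLeft_apply]
      rw [hφ s hs k hk hD, key F N d s hs k hk hD]
    exact LinearMap.congr_fun h x
  have hinj : Function.Injective φ := by
    rw [injective_iff_map_eq_zero]
    intro x hx
    obtain ⟨n, rfl⟩ : ∃ n, N = n + 1 := ⟨N - 1, by omega⟩
    apply PsiDom_inj F n d
    rw [hkey, hx, map_zero, map_zero, mul_zero]
  refine ⟨hinj, ?_, ?_⟩
  · have hle : LinearMap.range φ ≤ LinearMap.ker (mu F d N) := by
      rw [LinearMap.range_le_ker_iff]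
      apply dom_ext F N d hN
      intro s hs k hk hD
      rw [LinearMap.comp_apply, hφ s hs k hk hD, mu_vv F N d s hs k hk, LinearMap.zero_apply]
    have h := abstract_range F φ (mu F d N) hinj (mu_surj F d N) hle
    apply h
    have h1 := Module.finrank_tensorProduct (R := F) (S := F) (M := Sym' F (N - 1))
      (M' := ↥(⋀[F]^(N + 1) (Sym' F (d + 1))))
    have h2 := Module.finrank_tensorProduct (R := F) (S := F) (M := ↥(⋀[F]^N (Sym' F d)))
      (M' := Sym' F d)
    rw [exteriorPower.finrank_eq, finrank_sym, finrank_sym, Nat.sub_add_cancel hN] at h1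
    rw [exteriorPower.finrank_eq, finrank_sym] at h2
    rw [h1, h2, exteriorPower.finrank_eq, finrank_sym]
    exact numeric N d
  · intro g x
    apply PsiCod_inj F N d
    have hne : (-1) ^ N * brk F N ≠ 0 :=
      mul_ne_zero (pow_ne_zero _ (neg_ne_zero.mpr one_ne_zero)) (brk_ne F N)
    apply mul_left_cancel₀ hne
    rw [← hkey, GG_PsiDom, hkey, map_mul, GG_PsiCod, map_mul, GG_brk F N _ g.2]
    simp


end
end

section
/- Let (i,j) ∈ I(d,N) × {0,1,…,d} be semistandard, let α be maximal such that i_α ≤ j, and set k = (i_1,…,i_α, j+1, i_{α+1}+1,…,i_N+1) ∈ I(d+1,N+1) (which is strictly increasing). Then v_{(α−1,k)} = F_Δ(i,j) + v, where v is a linear combination of basis elements F_Δ(i′,j′) over semistandard pairs (i′,j′) with (i,j) ≺ (i′,j′). -/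
open MvPolynomial TensorProduct

set_option maxHeartbeats 1000000
set_option synthInstance.maxHeartbeats 400000

noncomputable section

variable (F : Type*) [Field F]

/-- Lexicographic comparison of contents, via their weakly increasing enumerations. -/
def contentLT {N : ℕ} (p q : (Fin N → ℕ) × ℕ) : Prop :=
  List.Lex (· < ·) ((ssContent p).sort (· ≤ ·)) ((ssContent q).sort (· ≤ ·))

/-- The total order `≺` on semistandard pairs: `(i,j) ≺ (i',j')` iff either the content of
`(i,j)` is lexicographically smaller, or the contents are equal and `j > j'`. -/
def Prec {N : ℕ} (p q : (Fin N → ℕ) × ℕ) : Prop :=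
  contentLT p q ∨ (ssContent p = ssContent q ∧ q.2 < p.2)

section helpers

lemma hp_sorted {N : ℕ} (i : Fin N → ℕ) (j : ℕ) (a : Fin N)
    (hm : StrictMono i) (h1 : i a ≤ j) (h2 : ∀ b, a < b → j ≤ i b) :
    (ssContent (i, j)).sort (· ≤ ·) =
      List.ofFn (Fin.insertNth (α := fun _ => ℕ) a.succ j i) := by
  set w : Fin (N+1) → ℕ := Fin.insertNth (α := fun _ => ℕ) a.succ j i with hw
  have hc : ssContent (i, j) = ((List.ofFn w : List ℕ) : Multiset ℕ) := by
    have : ((List.ofFn w : List ℕ) : Multiset ℕ) = Finset.univ.val.map w := by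
      rw [Fin.univ_val_map]
    rw [this, Fin.univ_succAbove N a.succ]
    simp [ssContent, hw, Function.comp_def]
  have hmono : Monotone w := by
    rw [Fin.monotone_iff_le_succ]
    intro b
    have key : ∀ b : Fin (N+1), w b = if h : (b:ℕ) ≤ a then i ⟨b, by omega⟩ else
        if (b:ℕ) = a + 1 then j else i ⟨b - 1, by omega⟩ := by
      intro b
      induction b using Fin.succAboveCases a.succ with
      | x => simp [hw]
      | p b =>
        rw [hw, Fin.insertNth_apply_succAbove]
        by_cases hb : b ≤ a
        · have : (a.succ.succAbove b) = b.castSucc :=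
            Fin.succAbove_of_castSucc_lt _ _ (by simp [Fin.lt_def]; omega)
          simp [this, hb]
        · have : (a.succ.succAbove b) = b.succ :=
            Fin.succAbove_of_le_castSucc _ _ (by simp [Fin.le_def]; omega)
          have h3 : ¬ ((b:ℕ) + 1 ≤ a) := by omega
          have h4 : ¬ ((b:ℕ) = a) := by omega
          simp [this, h3, h4]
    rw [key, key]
    simp only [Fin.val_castSucc, Fin.val_succ]
    split_ifs with e1 e2 e3 e4 e5 e6 <;> try omega
    · exact hm.monotone (by simp [Fin.le_def])
    · have : (⟨b, by omega⟩ : Fin N) = a := by ext; simp; omega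
      rw [this]; exact h1
    · apply h2; rw [Fin.lt_def]; show (a : ℕ) < b; omega
    · exact hm.monotone (by simp [Fin.le_def])
  rw [hc]
  rw [Multiset.coe_sort]
  apply List.mergeSort_of_pairwise
  simpa using hmono.sortedLE_ofFn.pairwise

lemma hp_lex {n : ℕ} (w w' : Fin n → ℕ) (m : Fin n) (h : ∀ b < m, w b = w' b)
    (hlt : w m < w' m) : List.Lex (· < ·) (List.ofFn w) (List.ofFn w') := by
  have : List.ofFn w < List.ofFn w' := by
    rw [List.lt_iff_exists]
    right
    refine ⟨m, by simp, by simp, ?_, by simpa using hlt⟩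
    intro b hb
    simpa using h ⟨b, by omega⟩ hb
  exact this

/-- the last coordinate -/
def hpJ {N : ℕ} (s : ℕ) (k : Fin (N+1) → ℕ) (x : Fin N → ℕ) : ℕ :=
  s + (∑ a, k a) - N - ∑ a, x a

lemma hp_mem_box {N : ℕ} (k : Fin (N+1) → ℕ) (x : Fin N → ℕ) :
    x ∈ box k ↔ ∀ a : Fin N, k a.castSucc ≤ x a ∧ x a < k a.succ := by
  simp [box]

lemma hp_bound_lo {N : ℕ} (s : ℕ) (k : Fin (N+1) → ℕ) (x : Fin N → ℕ) (hx : x ∈ box k) :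
    hpJ s k x + N + ∑ a, x a = s + ∑ a, k a ∧ k 0 ≤ hpJ s k x := by
  rw [hp_mem_box] at hx
  have h1 : ∑ a : Fin N, (x a + 1) ≤ ∑ a : Fin N, k a.succ :=
    Finset.sum_le_sum fun a _ => (hx a).2
  rw [Finset.sum_add_distrib] at h1
  simp at h1
  have h2 := Fin.sum_univ_succ k
  unfold hpJ
  omega

lemma hp_bound_hi {N : ℕ} (s : ℕ) (hs : s < N) (k : Fin (N+1) → ℕ) (x : Fin N → ℕ)
    (hx : x ∈ box k) : hpJ s k x < k (Fin.last N) := by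
  have h0 := (hp_bound_lo s k x hx).1
  rw [hp_mem_box] at hx
  have h1 : ∑ a : Fin N, k a.castSucc ≤ ∑ a : Fin N, x a :=
    Finset.sum_le_sum fun a _ => (hx a).1
  have h2 := Fin.sum_univ_castSucc k
  omega

/-- upper estimate used for the comparison of contents -/
lemma hp_bound_mid {N : ℕ} (s : ℕ) (k : Fin (N+1) → ℕ) (x : Fin N → ℕ)
    (hx : x ∈ box k) (a : Fin N) (ha : ∀ b ≤ a, x b = k b.castSucc) :
    k a.succ + s ≤ hpJ s k x + 1 + a := by
  have h0 := (hp_bound_lo s k x hx).1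
  rw [hp_mem_box] at hx
  have h1 : ∑ b : Fin N, (x b + if a < b then 1 else 0) ≤
      ∑ b : Fin N, k (a.succ.succAbove b) := by
    refine Finset.sum_le_sum fun b _ => ?_
    by_cases hb : b ≤ a
    · have : (a.succ.succAbove b) = b.castSucc :=
        Fin.succAbove_of_castSucc_lt _ _ (by simp [Fin.lt_def]; omega)
      simp [this, ha b hb, not_lt.mpr hb]
    · have : (a.succ.succAbove b) = b.succ :=
        Fin.succAbove_of_le_castSucc _ _ (by simp [Fin.le_def]; omega)
      rw [this, if_pos (not_le.mp hb)]
      exact (hx b).2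
  rw [Finset.sum_add_distrib] at h1
  have h3 : (∑ b : Fin N, if a < b then 1 else 0) = N - 1 - a := by
    rw [← Finset.card_filter, ← Fin.card_Ioi]
    congr 1; ext; simp
  have h2 := Fin.sum_univ_succAbove k a.succ
  omega

lemma hp_exists {N : ℕ} (k : Fin (N+1) → ℕ) (y : ℕ) (h0 : k 0 ≤ y)
    (h1 : y < k (Fin.last N)) : ∃ a : Fin N, k a.castSucc ≤ y ∧ y < k a.succ := by
  by_contra hcon
  push Not at hcon
  have : ∀ b : Fin (N+1), k b ≤ y := by
    intro b
    induction b using Fin.induction with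
    | zero => exact h0
    | succ b ih => exact hcon b ih
  have := this (Fin.last N)
  omega

lemma hp_unique {N : ℕ} (k : Fin (N+1) → ℕ) (hk : StrictMono k) (y y' : ℕ) (a b : Fin N)
    (h1 : k a.castSucc ≤ y) (h2 : y' < k b.succ) (h : y ≤ y') : a ≤ b := by
  by_contra hlt
  push Not at hlt
  have : k b.succ ≤ k a.castSucc := hk.monotone (by simp [Fin.le_def]; omega)
  omega

lemma hp_strictMono {N : ℕ} (k : Fin (N+1) → ℕ) (hk : StrictMono k) (x : Fin N → ℕ)
    (hx : x ∈ box k) : StrictMono x := by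
  rw [hp_mem_box] at hx
  intro a b hab
  have : k a.succ ≤ k b.castSucc := hk.monotone (by simp [Fin.le_def]; omega)
  have := hx a
  have := hx b
  omega

lemma hp_FDelta {N : ℕ} (F : Type*) [Field F] (d : ℕ) (k : Fin (N+1) → ℕ) (hk : StrictMono k)
    (x : Fin N → ℕ) (hx : x ∈ box k) (y : ℕ) (a : Fin N) (h1 : k a.castSucc ≤ y)
    (h2 : y < k a.succ) (hle : x a ≤ y) :
    FDelta F d (x, y) = Fp F d x y +
      if x a < y then Fp F d (Function.update x a y) (x a) else 0 := by
  rw [hp_mem_box] at hx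
  by_cases he : x a = y
  · have : ∃ a, x a = y := ⟨a, he⟩
    simp [FDelta, this, he]
  · have hn : ¬ ∃ b, x b = y := by
      rintro ⟨b, hb⟩
      have e1 := hp_unique k hk y (x b) a b h1 (hx b).2 hb.ge
      have e2 := hp_unique k hk (x b) y b a (hx b).1 h2 hb.le
      exact he (by rw [le_antisymm e1 e2, hb])
    have hP : Pmap (x, y) = (Function.update x a y, x a) := by
      have hne : (Finset.univ.filter fun b : Fin N => x b ≤ y).Nonempty := ⟨a, by simpa using hle⟩
      have hmax : (Finset.univ.filter fun b : Fin N => x b ≤ y).max' hne = a := by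
        apply le_antisymm
        · apply Finset.max'_le
          intro b hb
          simp at hb
          exact hp_unique k hk (x b) y b a (hx b).1 h2 hb
        · apply Finset.le_max'
          simpa using hle
      unfold Pmap
      rw [dif_pos hne]
      simp only [hmax]
    rw [FDelta, if_neg hn, hP, if_pos (lt_of_le_of_ne hle he)]

lemma hp_swap {N : ℕ} (s : ℕ) (k : Fin (N+1) → ℕ)
    (x : Fin N → ℕ) (hx : x ∈ box k) (a : Fin N) (h1 : k a.castSucc ≤ hpJ s k x)
    (h2 : hpJ s k x < k a.succ) :
    Function.update x a (hpJ s k x) ∈ box k ∧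
      hpJ s k (Function.update x a (hpJ s k x)) = x a := by
  have hb : Function.update x a (hpJ s k x) ∈ box k := by
    rw [hp_mem_box] at hx ⊢
    intro b
    by_cases hba : b = a
    · subst hba; simp [h1, h2]
    · simp [hba, hx b]
  refine ⟨hb, ?_⟩
  have e1 := (hp_bound_lo s k x hx).1
  have e2 := (hp_bound_lo s k _ hb).1
  have e3 := Finset.sum_update_of_mem (Finset.mem_univ a) x (hpJ s k x)
  have e4 := Finset.sum_sdiff (Finset.subset_univ {a}) (f := x)
  simp only [Finset.sum_singleton] at e4
  omega

lemma hp_vv {N : ℕ} (F : Type*) [Field F] (d s : ℕ) (hs : s < N) (k : Fin (N+1) → ℕ)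
    (hk : StrictMono k) (A : (Fin N → ℕ) → Fin N)
    (hA : ∀ x ∈ box k, k (A x).castSucc ≤ hpJ s k x ∧ hpJ s k x < k (A x).succ) :
    vv F d N s k = ∑ x ∈ (box k).filter (fun x => x (A x) ≤ hpJ s k x),
      FDelta F d (x, hpJ s k x) := by
  have hA' : ∀ x ∈ box k, A (Function.update x (A x) (hpJ s k x)) = A x := by
    intro x hx
    obtain ⟨e1, e2⟩ := hp_swap s k x hx (A x) (hA x hx).1 (hA x hx).2
    have e3 := hA _ e1
    rw [e2] at e3
    have e4 := (hp_mem_box k x).1 hx (A x)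
    exact le_antisymm (hp_unique k hk _ _ _ _ e3.1 e4.2 le_rfl)
      (hp_unique k hk _ _ _ _ e4.1 e3.2 le_rfl)
  have hR : ∀ x ∈ (box k).filter (fun x => x (A x) ≤ hpJ s k x),
      FDelta F d (x, hpJ s k x) = Fp F d x (hpJ s k x) + if x (A x) < hpJ s k x then
        Fp F d (Function.update x (A x) (hpJ s k x)) (x (A x)) else 0 := by
    intro x hx
    rw [Finset.mem_filter] at hx
    exact hp_FDelta F d k hk x hx.1 _ _ (hA x hx.1).1 (hA x hx.1).2 hx.2
  rw [Finset.sum_congr rfl hR, Finset.sum_add_distrib]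
  have hL : vv F d N s k = ∑ x ∈ box k, Fp F d x (hpJ s k x) := rfl
  rw [hL, ← Finset.sum_filter_add_sum_filter_not (box k) (fun x => x (A x) ≤ hpJ s k x)]
  congr 1
  rw [← Finset.sum_filter, Finset.filter_filter]
  symm
  refine Finset.sum_bij' (fun x _ => Function.update x (A x) (hpJ s k x))
    (fun x _ => Function.update x (A x) (hpJ s k x)) ?_ ?_ ?_ ?_ ?_
  · intro x hx
    rw [Finset.mem_filter] at hx ⊢
    obtain ⟨hx, -, hlt⟩ := hx
    obtain ⟨e1, e2⟩ := hp_swap s k x hx (A x) (hA x hx).1 (hA x hx).2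
    refine ⟨e1, ?_⟩
    rw [hA' x hx, e2]
    simpa using hlt
  · intro x hx
    rw [Finset.mem_filter] at hx ⊢
    obtain ⟨hx, hlt⟩ := hx
    obtain ⟨e1, e2⟩ := hp_swap s k x hx (A x) (hA x hx).1 (hA x hx).2
    refine ⟨e1, ?_⟩
    rw [hA' x hx, e2]
    simp at hlt ⊢
    omega
  · intro x hx
    rw [Finset.mem_filter] at hx
    obtain ⟨e1, e2⟩ := hp_swap s k x hx.1 (A x) (hA x hx.1).1 (hA x hx.1).2
    rw [hA' x hx.1, e2]
    simp
  · intro x hx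
    rw [Finset.mem_filter] at hx
    obtain ⟨e1, e2⟩ := hp_swap s k x hx.1 (A x) (hA x hx.1).1 (hA x hx.1).2
    rw [hA' x hx.1, e2]
    simp
  · intro x hx
    rw [Finset.mem_filter] at hx
    obtain ⟨e1, e2⟩ := hp_swap s k x hx.1 (A x) (hA x hx.1).1 (hA x hx.1).2
    rw [e2]

lemma hp_ins_le {N : ℕ} (a : Fin N) (j : ℕ) (i : Fin N → ℕ) (b : Fin N) (hb : b ≤ a) :
    (Fin.insertNth (α := fun _ => ℕ) a.succ j i : Fin (N+1) → ℕ) b.castSucc = i b := by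
  have : (a.succ.succAbove b) = b.castSucc :=
    Fin.succAbove_of_castSucc_lt _ _ (by simp [Fin.lt_def]; omega)
  rw [← this, Fin.insertNth_apply_succAbove]

/-- Comparison: all members of the filtered box other than `(i,j)` are larger. -/
lemma hp_prec {N : ℕ} (i : Fin N → ℕ) (j : ℕ) (hi : StrictMono i) (α : Fin N) (hα : i α ≤ j)
    (hα' : ∀ b, α < b → j < i b) (k : Fin (N+1) → ℕ) (hk : StrictMono k)
    (hk1 : ∀ b ≤ α, k b.castSucc = i b) (hk2 : k α.succ = j + 1)
    (hk3 : ∀ b, α < b → k b.succ = i b + 1)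
    (hi_mem : i ∈ box k) (hij : hpJ α k i = j)
    (x : Fin N → ℕ) (hx : x ∈ box k) (a : Fin N)
    (h1 : k a.castSucc ≤ hpJ α k x) (h2 : hpJ α k x < k a.succ) (hle : x a ≤ hpJ α k x)
    (hne : x ≠ i) : Prec (i, j) (x, hpJ α k x) := by
  left
  set y := hpJ α k x with hy
  have hxm := hp_strictMono k hk x hx
  have hxb := (hp_mem_box k x).1 hx
  unfold contentLT
  rw [hp_sorted i j α hi hα (fun b hb => (hα' b hb).le), hp_sorted x y a hxm hle]
  swap
  · intro b hb
    have : k a.succ ≤ k b.castSucc := hk.monotone (by simp [Fin.le_def]; omega)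
    have := hxb b
    omega
  -- compare
  by_cases hex : ∃ b, b ≤ α ∧ b ≤ a ∧ x b ≠ i b
  · -- least such b
    obtain ⟨b, hb, hmin⟩ : ∃ b, (b ≤ α ∧ b ≤ a ∧ x b ≠ i b) ∧
        ∀ c < b, ¬ (c ≤ α ∧ c ≤ a ∧ x c ≠ i c) := by
      obtain ⟨b, hb, hm⟩ := WellFounded.has_min (wellFounded_lt (α := Fin N))
        {b | b ≤ α ∧ b ≤ a ∧ x b ≠ i b} hex
      exact ⟨b, hb, fun c hc hc' => hm c hc' hc⟩
    apply hp_lex _ _ b.castSucc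
    · intro c hc
      obtain ⟨c, rfl⟩ : ∃ c' : Fin N, c = c'.castSucc :=
        ⟨⟨c, by have := Fin.lt_def.1 hc; simp at this; omega⟩, by ext; simp⟩
      have hcb : c < b := by simpa using hc
      rw [hp_ins_le _ _ _ _ (hcb.le.trans hb.1), hp_ins_le _ _ _ _ (hcb.le.trans hb.2.1)]
      by_contra hcc
      exact hmin c hcb ⟨hcb.le.trans hb.1, hcb.le.trans hb.2.1, fun e => hcc e.symm⟩
    · rw [hp_ins_le _ _ _ _ hb.1, hp_ins_le _ _ _ _ hb.2.1]
      have := (hxb b).1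
      rw [hk1 b hb.1] at this
      have := hb.2.2
      omega
  · push Not at hex
    rcases lt_trichotomy a α with hlt | heq | hgt
    · exfalso
      have := hp_bound_mid α k x hx a (fun b hb => by
        rw [hk1 b (hb.trans hlt.le), hex b (hb.trans hlt.le) hb])
      rw [← hy] at this
      have := Fin.lt_def.1 hlt
      omega
    · exfalso
      subst heq
      have e1 := hp_bound_mid a k x hx a (fun b hb => by rw [hk1 b hb, hex b hb hb])
      rw [← hy] at e1
      have e2 : y = j := by omega
      have e3 := (hp_bound_lo a k x hx).1
      have e4 := (hp_bound_lo a k i hi_mem).1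
      rw [hij] at e4
      rw [← hy, e2] at e3
      have e5 : ∀ b ∈ Finset.univ, x b ≤ i b := by
        intro b _
        by_cases hb : b ≤ a
        · exact (hex b hb hb).le
        · have := (hxb b).2
          rw [hk3 b (not_le.1 hb)] at this
          omega
      have e6 := (Finset.sum_eq_sum_iff_of_le e5).1 (by omega)
      exact hne (funext fun b => e6 b (Finset.mem_univ b))
    · have hlt := Fin.lt_def.1 hgt
      obtain ⟨b, hb⟩ : ∃ b : Fin N, (b : ℕ) = α + 1 := ⟨⟨α + 1, by omega⟩, rfl⟩
      have hbs : b.castSucc = α.succ := by ext; simp [hb]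
      apply hp_lex _ _ b.castSucc
      · intro c hc
        obtain ⟨c, rfl⟩ : ∃ c' : Fin N, c = c'.castSucc :=
          ⟨⟨c, by have := Fin.lt_def.1 hc; simp at this; omega⟩, by ext; simp⟩
        have hcb : c < b := by simpa using hc
        have hca : c ≤ α := by rw [Fin.le_def]; rw [Fin.lt_def] at hcb; omega
        rw [hp_ins_le _ _ _ _ hca, hp_ins_le _ _ _ _ (hca.trans hgt.le),
          hex c hca (hca.trans hgt.le)]
      · rw [hp_ins_le a _ _ b (by rw [Fin.le_def]; omega), hbs, Fin.insertNth_apply_same]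
        have := (hxb b).1
        rw [hbs, hk2] at this
        omega

end helpers

/-- Proposition 2.14 of the paper. Let `(i,j)` be semistandard, let `α` be
maximal with `i_α ≤ j`, and let `k = (i₁,…,i_α, j+1, i_{α+1}+1, …, i_N+1)` (which is strictly
increasing, with entries at most `d+1`). Then `v_{(α-1,k)} = F_Δ(i,j) + v` where `v` is a
linear combination of basis elements `F_Δ(i',j')` for semistandard pairs `(i',j') ≻ (i,j)`. -/
theorem statement16 (F : Type*) [Field F] (N d : ℕ) (hN : 0 < N)
    (i : Fin N → ℕ) (j : ℕ) (hss : IsSS d (i, j))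
    (α : Fin N) (hα : i α ≤ j) (hαmax : ∀ b : Fin N, i b ≤ j → b ≤ α) :
    let k : Fin (N + 1) → ℕ := fun b =>
      if hb : (b : ℕ) ≤ (α : ℕ) then i ⟨b, lt_of_le_of_lt hb α.isLt⟩
      else if (b : ℕ) = (α : ℕ) + 1 then j + 1
      else i ⟨(b : ℕ) - 1, by have := b.isLt; omega⟩ + 1
    StrictMono k ∧ (∀ b, k b ≤ d + 1) ∧
    ∃ c : ((Fin N → ℕ) × ℕ) →₀ F,
      (∀ p ∈ c.support, IsSS d p ∧ Prec (i, j) p) ∧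
      vv F d N (α : ℕ) k = FDelta F d (i, j) + (c.sum fun p r => r • FDelta F d p) := by
  intro k
  obtain ⟨hi, hid, hjd, -⟩ := hss
  simp only at hi hid hjd
  have hα' : ∀ b, α < b → j < i b := by
    intro b hb
    by_contra h
    exact absurd (hαmax b (not_lt.1 h)) (not_le.2 hb)
  have hk1 : ∀ b ≤ α, k b.castSucc = i b := by
    intro b hb
    have : (b : ℕ) ≤ α := hb
    simp [k, this]
  have hk2 : k α.succ = j + 1 := by simp [k]
  have hk3 : ∀ b, α < b → k b.succ = i b + 1 := by
    intro b hb
    have : (α : ℕ) < b := hb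
    have e1 : ¬ ((b : ℕ) + 1 ≤ α) := by omega
    have e2 : ¬ ((b : ℕ) = α) := by omega
    simp [k, e1, e2]
  -- the shape of `i` inside the box
  have hi_box : ∀ a : Fin N, k a.castSucc ≤ i a ∧ i a < k a.succ := by
    intro a
    rcases lt_trichotomy a α with h | h | h
    · rw [hk1 a h.le]
      refine ⟨le_rfl, ?_⟩
      have hlt := Fin.lt_def.1 h
      obtain ⟨b, hb⟩ : ∃ b : Fin N, (b : ℕ) = a + 1 := ⟨⟨a + 1, by omega⟩, rfl⟩
      have : a.succ = b.castSucc := by ext; simp [hb]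
      rw [this, hk1 b (by rw [Fin.le_def]; omega)]
      exact hi (by rw [Fin.lt_def]; omega)
    · subst h
      rw [hk1 a le_rfl, hk2]
      omega
    · rw [hk3 a h]
      refine ⟨?_, by omega⟩
      have hlt := Fin.lt_def.1 h
      obtain ⟨b, hb⟩ : ∃ b : Fin N, (b : ℕ) + 1 = a := ⟨⟨a - 1, by omega⟩, by simp; omega⟩
      have : a.castSucc = b.succ := by ext; simp [hb]
      rw [this]
      have hba : b < a := by rw [Fin.lt_def]; omega
      have hab : α ≤ b := by rw [Fin.le_def]; omega
      rcases hab.eq_or_lt with e | e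
      · rw [← e, hk2]; exact hα' a h
      · rw [hk3 b e]; exact hi hba
  have hi_mem : i ∈ box k := (hp_mem_box k i).2 hi_box
  have hk : StrictMono k := by
    rw [Fin.strictMono_iff_lt_succ]
    intro a
    exact (hi_box a).1.trans_lt (hi_box a).2
  have hkd : ∀ b, k b ≤ d + 1 := by
    intro b
    simp only [k]
    split_ifs
    · exact (hid _).trans (by omega)
    · omega
    · exact Nat.succ_le_succ (hid _)
  refine ⟨hk, hkd, ?_⟩
  have hij : hpJ α k i = j := by
    have e0 := (hp_bound_lo α k i hi_mem).1
    have h1 : ∑ b : Fin N, (i b + if α < b then 1 else 0) =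
        ∑ b : Fin N, k (α.succ.succAbove b) := by
      refine Finset.sum_congr rfl fun b _ => ?_
      by_cases hb : b ≤ α
      · have : (α.succ.succAbove b) = b.castSucc :=
          Fin.succAbove_of_castSucc_lt _ _ (by simp [Fin.lt_def]; omega)
        simp [this, hk1 b hb, not_lt.mpr hb]
      · have : (α.succ.succAbove b) = b.succ :=
          Fin.succAbove_of_le_castSucc _ _ (by simp [Fin.le_def]; omega)
        rw [this, if_pos (not_le.mp hb), hk3 b (not_le.mp hb)]
    rw [Finset.sum_add_distrib] at h1
    have h3 : (∑ b : Fin N, if α < b then 1 else 0) = N - 1 - α := by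
      rw [← Finset.card_filter, ← Fin.card_Ioi]
      congr 1; ext; simp
    have h2 := Fin.sum_univ_succAbove k α.succ
    have := α.isLt
    omega
  have hexA : ∀ x : Fin N → ℕ, ∃ a : Fin N, x ∈ box k →
      k a.castSucc ≤ hpJ α k x ∧ hpJ α k x < k a.succ := by
    intro x
    by_cases hx : x ∈ box k
    · obtain ⟨a, ha⟩ := hp_exists k (hpJ α k x) (hp_bound_lo α k x hx).2
        (hp_bound_hi α α.isLt k x hx)
      exact ⟨a, fun _ => ha⟩
    · exact ⟨α, fun h => absurd h hx⟩
  choose A hA using hexA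
  have hAi : A i = α := by
    have e := hA i hi_mem
    rw [hij] at e
    have e1 : k α.castSucc ≤ j := by rw [hk1 α le_rfl]; exact hα
    exact le_antisymm (hp_unique k hk _ _ _ _ e.1 (by omega) le_rfl)
      (hp_unique k hk _ _ _ _ e1 e.2 le_rfl)
  rw [hp_vv F d α α.isLt k hk A hA]
  set S := (box k).filter (fun x => x (A x) ≤ hpJ α k x) with hS
  have hiS : i ∈ S := by
    rw [hS, Finset.mem_filter, hAi, hij]
    exact ⟨hi_mem, hα⟩
  refine ⟨∑ x ∈ S.erase i, Finsupp.single (x, hpJ α k x) 1, ?_, ?_⟩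
  · intro p hp
    have hp' := Finsupp.support_finsetSum hp
    rw [Finset.mem_biUnion] at hp'
    obtain ⟨x, hx, hpx⟩ := hp'
    have hpe := Finsupp.support_single_subset hpx
    rw [Finset.mem_singleton] at hpe
    subst hpe
    rw [Finset.mem_erase, hS, Finset.mem_filter] at hx
    obtain ⟨hne, hxb, hle⟩ := hx
    have hxm := hp_strictMono k hk x hxb
    refine ⟨⟨hxm, ?_, ?_, ?_⟩, hp_prec i j hi α hα hα' k hk hk1 hk2 hk3 hi_mem hij x hxb (A x)
      (hA x hxb).1 (hA x hxb).2 hle hne⟩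
    · intro a
      have e1 := ((hp_mem_box k x).1 hxb a).2
      have e2 := hkd a.succ
      simp only
      omega
    · have e1 := (hA x hxb).2
      have e2 := hkd (A x).succ
      simp only
      omega
    · intro a ha
      exact (hxm.monotone (by rw [Fin.le_def]; omega)).trans hle
  · rw [← Finset.add_sum_erase S _ hiS, hij]
    congr 1
    have : ∀ c : ((Fin N → ℕ) × ℕ) →₀ F, (c.sum fun p r => r • FDelta F d p) =
        Finsupp.linearCombination F (fun p => FDelta F d p) c := fun c => rfl
    rw [this, map_sum]
    simp


end
end
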